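/- arXiv:2112.12711 — 11 statements merged into one kernel-verified Lean document; each statement's English description precedes it below -/
import Mathlib

section
/- Let a₁, a₃ : (0,∞) × (0,π) → ℝ be differentiable functions satisfying, for all (r,θ) ∈ (0,∞) × (0,π): ∂a₃/∂r = 0, ∂a₃/∂θ = (cos θ / sin θ)·a₃(r,θ), ∂a₁/∂θ = −a₃(r,θ), and r·∂a₁/∂r = a₁(r,θ) − (cos θ / sin θ)·a₃(r,θ). Then there exist constants k₁, k₂ ∈ ℝ such that for all (r,θ) ∈ (0,∞) × (0,π): a₁(r,θ) = k₁·cos θ + k₂·r and a₃(r,θ) = k₁·sin θ. -/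
open Real Set

theorem eq_of_hasDerivAt_zero {f : ℝ → ℝ} {s : Set ℝ} (hs : IsOpen s)
    (hs' : IsPreconnected s) (hf : ∀ x ∈ s, HasDerivAt f 0 x) {x y : ℝ}
    (hx : x ∈ s) (hy : y ∈ s) : f x = f y :=
  hs.is_const_of_deriv_eq_zero hs'
    (fun z hz => (hf z hz).differentiableAt.differentiableWithinAt)
    (fun z hz => (hf z hz).deriv) hx hy

/-- The PDE system for the coefficients of a torus-invariant self-dual
twistor 2-form on ℝ³ × S¹ in spherical coordinates forces
`a₁ = k₁ cos θ + k₂ r` and `a₃ = k₁ sin θ`. -/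
theorem twistor_coefficients_on_flat_model
    (a₁ a₃ : ℝ → ℝ → ℝ)
    (hdiff₁ : ∀ r ∈ Ioi (0:ℝ), ∀ θ ∈ Ioo (0:ℝ) π,
      DifferentiableAt ℝ (fun p : ℝ × ℝ => a₁ p.1 p.2) (r, θ))
    (hdiff₃ : ∀ r ∈ Ioi (0:ℝ), ∀ θ ∈ Ioo (0:ℝ) π,
      DifferentiableAt ℝ (fun p : ℝ × ℝ => a₃ p.1 p.2) (r, θ))
    (h₁ : ∀ r ∈ Ioi (0:ℝ), ∀ θ ∈ Ioo (0:ℝ) π,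
      deriv (fun r' => a₃ r' θ) r = 0)
    (h₂ : ∀ r ∈ Ioi (0:ℝ), ∀ θ ∈ Ioo (0:ℝ) π,
      deriv (fun θ' => a₃ r θ') θ = (Real.cos θ / Real.sin θ) * a₃ r θ)
    (h₃ : ∀ r ∈ Ioi (0:ℝ), ∀ θ ∈ Ioo (0:ℝ) π,
      deriv (fun θ' => a₁ r θ') θ = - a₃ r θ)
    (h₄ : ∀ r ∈ Ioi (0:ℝ), ∀ θ ∈ Ioo (0:ℝ) π,
      r * deriv (fun r' => a₁ r' θ) r = a₁ r θ - (Real.cos θ / Real.sin θ) * a₃ r θ) :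
    ∃ k₁ k₂ : ℝ, ∀ r ∈ Ioi (0:ℝ), ∀ θ ∈ Ioo (0:ℝ) π,
      a₁ r θ = k₁ * Real.cos θ + k₂ * r ∧ a₃ r θ = k₁ * Real.sin θ := by
  have hasDeriv_r : ∀ f : ℝ → ℝ → ℝ, ∀ r θ,
      DifferentiableAt ℝ (fun p : ℝ × ℝ => f p.1 p.2) (r, θ) →
      HasDerivAt (fun r' => f r' θ) (deriv (fun r' => f r' θ) r) r := fun f r θ hf =>
    (hf.comp (f := fun r' => (r', θ)) r (by fun_prop)).hasDerivAt
  have hasDeriv_θ : ∀ f : ℝ → ℝ → ℝ, ∀ r θ,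
      DifferentiableAt ℝ (fun p : ℝ × ℝ => f p.1 p.2) (r, θ) →
      HasDerivAt (fun θ' => f r θ') (deriv (fun θ' => f r θ') θ) θ := fun f r θ hf =>
    (hf.comp (f := fun θ' => (r, θ')) θ (by fun_prop)).hasDerivAt
  have one_mem : (1 : ℝ) ∈ Ioi (0 : ℝ) := mem_Ioi.mpr one_pos
  have half_mem : π / 2 ∈ Ioo (0 : ℝ) π := ⟨by positivity, by linarith [pi_pos]⟩
  have a₃_indep : ∀ r ∈ Ioi (0 : ℝ), ∀ θ ∈ Ioo (0 : ℝ) π, a₃ r θ = a₃ 1 θ := fun r hr θ hθ =>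
    eq_of_hasDerivAt_zero isOpen_Ioi isPreconnected_Ioi
      (fun x hx => h₁ x hx θ hθ ▸ hasDeriv_r a₃ x θ (hdiff₃ x hx θ hθ)) hr one_mem
  have a₃_eq : ∀ r ∈ Ioi (0 : ℝ), ∀ θ ∈ Ioo (0 : ℝ) π,
      a₃ r θ = a₃ 1 (π / 2) * Real.sin θ := by
    intro r hr θ hθ
    have hconst : a₃ 1 θ / Real.sin θ = a₃ 1 (π / 2) / Real.sin (π / 2) :=
      eq_of_hasDerivAt_zero (f := fun x => a₃ 1 x / Real.sin x) isOpen_Ioo isPreconnected_Ioo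
        (fun x hx => by
          have hsin : Real.sin x ≠ 0 := (sin_pos_of_mem_Ioo hx).ne'
          have hd := (hasDeriv_θ a₃ 1 x (hdiff₃ 1 one_mem x hx)).div (Real.hasDerivAt_sin x) hsin
          rw [h₂ 1 one_mem x hx] at hd
          refine hd.congr_deriv ?_
          field_simp
          ring) hθ half_mem
    rw [sin_pi_div_two, div_one, div_eq_iff (sin_pos_of_mem_Ioo hθ).ne'] at hconst
    rw [a₃_indep r hr θ hθ, hconst]
  have a₁_equator : ∀ r ∈ Ioi (0 : ℝ), a₁ r (π / 2) = a₁ 1 (π / 2) * r := by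
    intro r hr
    have hconst : a₁ r (π / 2) / r = a₁ 1 (π / 2) / 1 :=
      eq_of_hasDerivAt_zero (f := fun x => a₁ x (π / 2) / x) isOpen_Ioi isPreconnected_Ioi
        (fun x hx => by
          have hx0 : x ≠ 0 := (mem_Ioi.mp hx).ne'
          refine ((hasDeriv_r a₁ x _ (hdiff₁ x hx _ half_mem)).div
            (hasDerivAt_id x) hx0).congr_deriv ?_
          have hradial := h₄ x hx _ half_mem
          rw [cos_pi_div_two, zero_div, zero_mul, sub_zero] at hradial
          simp only [id, ← hradial]
          ring) hr one_mem
    rwa [div_one, div_eq_iff (mem_Ioi.mp hr).ne'] at hconst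
  refine ⟨a₃ 1 (π / 2), a₁ 1 (π / 2), fun r hr θ hθ => ⟨?_, a₃_eq r hr θ hθ⟩⟩
  have hconst : a₁ r θ - a₃ 1 (π / 2) * Real.cos θ =
      a₁ r (π / 2) - a₃ 1 (π / 2) * Real.cos (π / 2) :=
    eq_of_hasDerivAt_zero (f := fun x => a₁ r x - a₃ 1 (π / 2) * Real.cos x)
      isOpen_Ioo isPreconnected_Ioo
      (fun x hx => by
        refine ((hasDeriv_θ a₁ r x (hdiff₁ r hr x hx)).sub
          ((Real.hasDerivAt_cos x).const_mul (a₃ 1 (π / 2)))).congr_deriv ?_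
        rw [h₃ r hr x hx, a₃_eq r hr x hx]
        ring) hθ half_mem
  rw [cos_pi_div_two, mul_zero, sub_zero, a₁_equator r hr] at hconst
  linarith
end

section
/- Let Ω ⊆ {(ρ,z) ∈ ℝ² : ρ > 0} be open and let U : ℝ² → ℝ be three times continuously differentiable on Ω and satisfy the axisymmetric Laplace equation ∂²U/∂ρ² + (1/ρ)·∂U/∂ρ + ∂²U/∂z² = 0 on Ω. Define Φ : Ω → ℝ² by Φ(ρ,z) = ((ρ/2)·∂U/∂ρ(ρ,z), −(1/2)·∂U/∂z(ρ,z)). Suppose Ω' ⊆ ℝ² is open and ψ : Ω' → Ω is twice continuously differentiable with Φ ∘ ψ = id on Ω' and ψ ∘ Φ = id on Ω. Write ψ(ξ,x₂) = (P(ξ,x₂), Z(ξ,x₂)) and set u(ξ,x₂) := log(P(ξ,x₂)²). Then for all (ξ,x₂) ∈ Ω': ∂²(e^u)/∂ξ² + ∂²u/∂x₂² = 0, i.e. ∂²(P²)/∂ξ² + 2·∂²(log P)/∂x₂² = 0. -/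
open Real Set

/-- Partial derivative with respect to the first variable. -/
noncomputable def pdr (U : ℝ → ℝ → ℝ) (ρ z : ℝ) : ℝ := deriv (fun t => U t z) ρ

/-- Partial derivative with respect to the second variable. -/
noncomputable def pdz (U : ℝ → ℝ → ℝ) (ρ z : ℝ) : ℝ := deriv (fun t => U ρ t) z

/-- Second partial derivative with respect to the second variable. -/
noncomputable def pdzz (U : ℝ → ℝ → ℝ) (ρ z : ℝ) : ℝ := deriv (fun t => pdz U ρ t) z

/-- Second partial derivative with respect to the first variable. -/
noncomputable def pdrr (U : ℝ → ℝ → ℝ) (ρ z : ℝ) : ℝ := deriv (fun t => pdr U t z) ρ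

open scoped Topology
open Filter

theorem pdr_eq_fderiv {F : ℝ × ℝ → ℝ} {p : ℝ × ℝ} (hF : DifferentiableAt ℝ F p) :
    pdr (fun a b => F (a, b)) p.1 p.2 = fderiv ℝ F p (1, 0) := by
  have h : HasDerivAt (fun t : ℝ => (t, p.2)) ((1 : ℝ), (0 : ℝ)) p.1 :=
    (hasDerivAt_id p.1).prodMk (hasDerivAt_const p.1 p.2)
  exact (hF.hasFDerivAt.comp_hasDerivAt (x := p.1) (f := fun t : ℝ => (t, p.2)) h).deriv

theorem pdz_eq_fderiv {F : ℝ × ℝ → ℝ} {p : ℝ × ℝ} (hF : DifferentiableAt ℝ F p) :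
    pdz (fun a b => F (a, b)) p.1 p.2 = fderiv ℝ F p (0, 1) := by
  have h : HasDerivAt (fun t : ℝ => (p.1, t)) ((0 : ℝ), (1 : ℝ)) p.2 :=
    (hasDerivAt_const p.2 p.1).prodMk (hasDerivAt_id p.2)
  exact (hF.hasFDerivAt.comp_hasDerivAt (x := p.2) (f := fun t : ℝ => (p.1, t)) h).deriv

theorem pdrr_eq_fderiv {f : ℝ → ℝ → ℝ} {g : ℝ × ℝ → ℝ} {p : ℝ × ℝ}
    (hfg : ∀ᶠ q in 𝓝 p, pdr f q.1 q.2 = g q) (hg : DifferentiableAt ℝ g p) :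
    pdrr f p.1 p.2 = fderiv ℝ g p (1, 0) := by
  rw [← pdr_eq_fderiv hg]
  have hc : Tendsto (fun t : ℝ => (t, p.2)) (𝓝 p.1) (𝓝 p) :=
    Continuous.tendsto' (by fun_prop) _ _ rfl
  exact EventuallyEq.deriv_eq (hc.eventually hfg)

theorem pdzz_eq_fderiv {f : ℝ → ℝ → ℝ} {g : ℝ × ℝ → ℝ} {p : ℝ × ℝ}
    (hfg : ∀ᶠ q in 𝓝 p, pdz f q.1 q.2 = g q) (hg : DifferentiableAt ℝ g p) :
    pdzz f p.1 p.2 = fderiv ℝ g p (0, 1) := by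
  rw [← pdz_eq_fderiv hg]
  have hc : Tendsto (fun t : ℝ => (p.1, t)) (𝓝 p.2) (𝓝 p) :=
    Continuous.tendsto' (by fun_prop) _ _ rfl
  exact EventuallyEq.deriv_eq (hc.eventually hfg)

section DirectionalDerivative

variable {E : Type*} [NormedAddCommGroup E] [NormedSpace ℝ E] {F : E → ℝ} {p : E}

theorem ContDiffAt.differentiableAt_fderiv_apply (hF : ContDiffAt ℝ 2 F p) (v : E) :
    DifferentiableAt ℝ (fun x => fderiv ℝ F x v) p :=
  ((hF.fderiv_right (m := 1) (by norm_num)).differentiableAt (by norm_num)).clm_apply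
    (differentiableAt_const v)

theorem ContDiffAt.fderiv_fderiv_apply_comm (hF : ContDiffAt ℝ 2 F p) (v w : E) :
    fderiv ℝ (fun x => fderiv ℝ F x v) p w = fderiv ℝ (fun x => fderiv ℝ F x w) p v := by
  have hd : DifferentiableAt ℝ (fderiv ℝ F) p :=
    (hF.fderiv_right (m := 1) (by norm_num)).differentiableAt (by norm_num)
  have key (a b : E) : fderiv ℝ (fun x => fderiv ℝ F x a) p b = fderiv ℝ (fderiv ℝ F) p b a := by
    simp [fderiv_clm_apply hd (differentiableAt_const a)]
  rw [key, key]
  exact hF.isSymmSndFDerivAt (by simp) w v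

end DirectionalDerivative

/-- A right inverse of a matrix of the shape of the Jacobian of
`(ρ, z) ↦ ((ρ / 2) U_ρ, -(1 / 2) U_z)` for an axisymmetric harmonic `U` satisfies
Cauchy–Riemann type relations. -/
theorem right_inverse_relations {ρ b c Pξ Px Zξ Zx : ℝ} (hρ : ρ ≠ 0)
    (h₁ : -(ρ * c / 2) * Pξ + ρ * b / 2 * Zξ = 1) (h₂ : -(b / 2) * Pξ - c / 2 * Zξ = 0)
    (h₃ : -(ρ * c / 2) * Px + ρ * b / 2 * Zx = 0) (h₄ : -(b / 2) * Px - c / 2 * Zx = 1) :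
    ρ * Pξ = Zx ∧ Px = -(ρ * Zξ) := by
  have h₃' : -c * Px + b * Zx = 0 := by
    apply mul_left_cancel₀ hρ
    linear_combination 2 * h₃
  have e₁ : c * (Zx - ρ * Pξ) + b * (Px + ρ * Zξ) = 0 := by
    linear_combination 2 * h₁ - 2 * h₄
  have e₂ : b * (Zx - ρ * Pξ) - c * (Px + ρ * Zξ) = 0 := by
    linear_combination 2 * ρ * h₂ + h₃'
  have hbc : b ^ 2 + c ^ 2 ≠ 0 := by
    intro h
    have hb : b = 0 := by nlinarith [sq_nonneg b, sq_nonneg c]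
    have hc : c = 0 := by nlinarith [sq_nonneg b, sq_nonneg c]
    simp [hb, hc] at h₄
  constructor
  · apply mul_left_cancel₀ hbc
    linear_combination -c * e₁ - b * e₂
  · apply mul_left_cancel₀ hbc
    linear_combination b * e₁ - c * e₂

/-- the Ward–Tod Bäcklund transformation: if `U` solves the axisymmetric
Laplace equation on `Ω ⊆ {ρ > 0}` and `ψ` is a (two-sided) inverse of
`Φ(ρ,z) = ((ρ/2)U_ρ, −(1/2)U_z)`, then `u = log(P²)` (with `P` the first component
of `ψ`) solves the SU(∞)-Toda equation `(e^u)_{ξξ} + u_{x₂x₂} = 0`, i.e.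
`(P²)_{ξξ} + 2(log P)_{x₂x₂} = 0`. -/
theorem ward_tod_backlund
    (Ω : Set (ℝ × ℝ)) (hΩopen : IsOpen Ω) (hΩ : Ω ⊆ {p : ℝ × ℝ | 0 < p.1})
    (U : ℝ → ℝ → ℝ)
    (hU : ContDiffOn ℝ 3 (fun p : ℝ × ℝ => U p.1 p.2) Ω)
    (hlap : ∀ p ∈ Ω,
      pdrr U p.1 p.2 + (1 / p.1) * pdr U p.1 p.2 + pdzz U p.1 p.2 = 0)
    (Φ : ℝ × ℝ → ℝ × ℝ)
    (hΦ : ∀ p : ℝ × ℝ,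
      Φ p = (p.1 / 2 * pdr U p.1 p.2, -(1 / 2) * pdz U p.1 p.2))
    (Ω' : Set (ℝ × ℝ)) (hΩ'open : IsOpen Ω')
    (ψ : ℝ × ℝ → ℝ × ℝ)
    (hψmaps : MapsTo ψ Ω' Ω)
    (hψ : ContDiffOn ℝ 2 ψ Ω')
    (hleft : ∀ q ∈ Ω', Φ (ψ q) = q)
    (hright : ∀ p ∈ Ω, ψ (Φ p) = p)
    (P : ℝ → ℝ → ℝ)
    (hP : ∀ ξ x₂ : ℝ, P ξ x₂ = (ψ (ξ, x₂)).1) :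
    ∀ q ∈ Ω',
      pdrr (fun ξ x₂ => (P ξ x₂) ^ 2) q.1 q.2
        + 2 * pdzz (fun ξ x₂ => Real.log (P ξ x₂)) q.1 q.2 = 0 := by
  have hF₂ (p) (hp : p ∈ Ω) : ContDiffAt ℝ 2 (fun p : ℝ × ℝ => U p.1 p.2) p :=
    (hU.contDiffAt (hΩopen.mem_nhds hp)).of_le (by norm_num)
  set F : ℝ × ℝ → ℝ := fun p => U p.1 p.2
  have hF₁ (p) (hp : p ∈ Ω) : DifferentiableAt ℝ F p := (hF₂ p hp).differentiableAt (by norm_num)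
  have hUr (p) (hp : p ∈ Ω) : pdr U p.1 p.2 = fderiv ℝ F p (1, 0) := pdr_eq_fderiv (hF₁ p hp)
  have hUz (p) (hp : p ∈ Ω) : pdz U p.1 p.2 = fderiv ℝ F p (0, 1) := pdz_eq_fderiv (hF₁ p hp)
  set G : ℝ × ℝ → ℝ := fun p => fderiv ℝ F p (1, 0)
  set H : ℝ × ℝ → ℝ := fun p => fderiv ℝ F p (0, 1)
  have hGd (p) (hp : p ∈ Ω) : DifferentiableAt ℝ G p :=
    (hF₂ p hp).differentiableAt_fderiv_apply _
  have hHd (p) (hp : p ∈ Ω) : DifferentiableAt ℝ H p :=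
    (hF₂ p hp).differentiableAt_fderiv_apply _
  have hψ₂ (q) (hq : q ∈ Ω') : ContDiffAt ℝ 2 ψ q := hψ.contDiffAt (hΩ'open.mem_nhds hq)
  have hψd (q) (hq : q ∈ Ω') : DifferentiableAt ℝ ψ q :=
    (hψ₂ q hq).differentiableAt (by norm_num)
  set p₁ : ℝ × ℝ → ℝ := fun q => (ψ q).1 with hp₁
  set p₂ : ℝ × ℝ → ℝ := fun q => (ψ q).2 with hp₂
  have hp₁d (q) (hq : q ∈ Ω') : DifferentiableAt ℝ p₁ q := (hψd q hq).fst
  have hpos (q) (hq : q ∈ Ω') : 0 < p₁ q := hΩ (hψmaps hq)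
  have hrel (q) (hq : q ∈ Ω') :
      p₁ q * fderiv ℝ p₁ q (1, 0) = fderiv ℝ p₂ q (0, 1) ∧
        fderiv ℝ p₁ q (0, 1) = -(p₁ q * fderiv ℝ p₂ q (1, 0)) := by
    have hm := hψmaps hq
    have hsymm : fderiv ℝ G (ψ q) (0, 1) = fderiv ℝ H (ψ q) (1, 0) :=
      (hF₂ _ hm).fderiv_fderiv_apply_comm _ _
    have hl := hlap _ hm
    rw [hUr _ hm,
      pdrr_eq_fderiv (g := G) ((hΩopen.eventually_mem hm).mono hUr) (hGd _ hm),
      pdzz_eq_fderiv (g := H) ((hΩopen.eventually_mem hm).mono hUz) (hHd _ hm)] at hl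
    have hsplit (L : ℝ × ℝ →L[ℝ] ℝ) (v : ℝ × ℝ) :
        L (fderiv ℝ ψ q v) =
          fderiv ℝ p₁ q v * L (1, 0) + fderiv ℝ p₂ q v * L (0, 1) := by
      have e : fderiv ℝ ψ q v =
          fderiv ℝ p₁ q v • ((1 : ℝ), (0 : ℝ)) + fderiv ℝ p₂ q v • ((0 : ℝ), (1 : ℝ)) := by
        rw [hp₁, hp₂, fderiv.fst (hψd q hq), fderiv.snd (hψd q hq)]
        ext <;> simp
      rw [e, map_add, map_smul, map_smul, smul_eq_mul, smul_eq_mul]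
    have hGψ := (hGd _ hm).hasFDerivAt.comp q (hψd q hq).hasFDerivAt
    have hHψ := (hHd _ hm).hasFDerivAt.comp q (hψd q hq).hasFDerivAt
    have E₁ : HasFDerivAt (fun q => p₁ q * (1 / 2) * G (ψ q))
        (ContinuousLinearMap.fst ℝ ℝ ℝ) q := by
      refine hasFDerivAt_fst.congr_of_eventuallyEq ?_
      filter_upwards [hΩ'open.eventually_mem hq] with x hx
      have := congrArg Prod.fst (hleft x hx)
      rw [hΦ, hUr _ (hψmaps hx)] at this
      rw [← this, mul_one_div]
    have E₂ : HasFDerivAt (fun q => -(1 / 2) * H (ψ q)) (ContinuousLinearMap.snd ℝ ℝ ℝ) q := by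
      refine hasFDerivAt_snd.congr_of_eventuallyEq ?_
      filter_upwards [hΩ'open.eventually_mem hq] with x hx
      have := congrArg Prod.snd (hleft x hx)
      rw [hΦ, hUz _ (hψmaps hx)] at this
      exact this
    have k₁ (v : ℝ × ℝ) := DFunLike.congr_fun
      (E₁.unique (((hp₁d q hq).hasFDerivAt.mul_const (1 / 2 : ℝ)).mul hGψ)) v
    have k₂ (v : ℝ × ℝ) := DFunLike.congr_fun (E₂.unique (hHψ.const_mul (-(1 / 2) : ℝ))) v
    simp only [ContinuousLinearMap.coe_fst', ContinuousLinearMap.coe_snd',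
      add_apply, smul_apply, smul_eq_mul,
      ContinuousLinearMap.comp_apply, hsplit, hsymm] at k₁ k₂
    have hρ := (hpos q hq).ne'
    have hl' : G (ψ q) = -(p₁ q * (fderiv ℝ G (ψ q) (1, 0) + fderiv ℝ H (ψ q) (0, 1))) := by
      change fderiv ℝ G (ψ q) (1, 0) + 1 / p₁ q * G (ψ q) + fderiv ℝ H (ψ q) (0, 1) = 0 at hl
      field_simp at hl
      linear_combination hl
    refine right_inverse_relations (b := fderiv ℝ H (ψ q) (1, 0))
      (c := fderiv ℝ H (ψ q) (0, 1)) hρ ?_ ?_ ?_ ?_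
    · linear_combination -k₁ (1, 0) - fderiv ℝ p₁ q (1, 0) / 2 * hl'
    · linear_combination -k₂ (1, 0)
    · linear_combination -k₁ (0, 1) - fderiv ℝ p₁ q (0, 1) / 2 * hl'
    · linear_combination -k₂ (0, 1)
  intro q hq
  have hp₂C : ContDiffAt ℝ 2 p₂ q := (hψ₂ q hq).snd
  have hsq : ∀ᶠ x in 𝓝 q, pdr (fun ξ x₂ => P ξ x₂ ^ 2) x.1 x.2 = 2 * fderiv ℝ p₂ x (0, 1) := by
    filter_upwards [hΩ'open.eventually_mem hq] with x hx
    simp only [hP]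
    rw [pdr_eq_fderiv (F := fun x => p₁ x ^ 2) ((hp₁d x hx).pow 2),
      ((hp₁d x hx).hasFDerivAt.pow 2).fderiv]
    simp [← (hrel x hx).1, mul_assoc]
  have hlog : ∀ᶠ x in 𝓝 q,
      pdz (fun ξ x₂ => Real.log (P ξ x₂)) x.1 x.2 = -fderiv ℝ p₂ x (1, 0) := by
    filter_upwards [hΩ'open.eventually_mem hq] with x hx
    have hρ := (hpos x hx).ne'
    simp only [hP]
    rw [pdz_eq_fderiv (F := fun x => Real.log (p₁ x)) ((hp₁d x hx).log hρ),
      ((hp₁d x hx).hasFDerivAt.log hρ).fderiv, smul_apply, (hrel x hx).2,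
      smul_eq_mul]
    field_simp
  rw [pdrr_eq_fderiv hsq ((hp₂C.differentiableAt_fderiv_apply _).const_mul 2),
    pdzz_eq_fderiv hlog (hp₂C.differentiableAt_fderiv_apply _).neg,
    fderiv_const_mul (hp₂C.differentiableAt_fderiv_apply _), fderiv_fun_neg,
    smul_apply, neg_apply,
    hp₂C.fderiv_fderiv_apply_comm (0, 1) (1, 0), smul_eq_mul]
  ring
end

section
/- Fix n ∈ ℝ with n ≠ 0, and set k := 4n. For ρ > 0 set R := √(ρ²+z²), U := U_n where U_n(ρ,z) = 2R − 2z·log((R+z)/ρ) + 2n·log(ρ²), and H := H_n where H_n(ρ,z) = z·(R+4n) + ρ²·log((R+z)/ρ). Then for all ρ > 0 and z ∈ ℝ: (i) ρ²·((∂²U/∂ρ∂z)² + (∂²U/∂z²)²) = 4; (ii) −(1/k)·( ρ·∂U/∂ρ + (∂U/∂ρ)²·(∂²U/∂z²) / ((∂²U/∂ρ∂z)² + (∂²U/∂z²)²) ) = 1 + 2n/R; (iii) −(1/k)·( −ρ·(∂U/∂ρ)²·(∂²U/∂ρ∂z) / ((∂²U/∂ρ∂z)² + (∂²U/∂z²)²)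 + ρ²·∂U/∂z + 2H ) = 2nz/R. -/
open Real Set

/-- Mixed second partial derivative: first in the second variable, then in the first. -/
noncomputable def pdrz (U : ℝ → ℝ → ℝ) (ρ z : ℝ) : ℝ := deriv (fun t => pdz U t z) ρ

theorem sqrt_sq_add_sq_pos {ρ : ℝ} (z : ℝ) (hρ : 0 < ρ) : 0 < √(ρ ^ 2 + z ^ 2) :=
  Real.sqrt_pos.2 (by positivity)

theorem sqrt_sq_add_sq_add_pos {ρ : ℝ} (z : ℝ) (hρ : 0 < ρ) : 0 < √(ρ ^ 2 + z ^ 2) + z := by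
  have h : |z| < √(ρ ^ 2 + z ^ 2) := by
    rw [← Real.sqrt_sq_eq_abs]
    exact Real.sqrt_lt_sqrt (sq_nonneg z) (by nlinarith [pow_pos hρ 2])
  linarith [neg_abs_le z]

theorem hasDerivAt_sqrt_sq_add_sq_left {ρ : ℝ} (z : ℝ) (hρ : 0 < ρ) :
    HasDerivAt (fun t => √(t ^ 2 + z ^ 2)) (ρ / √(ρ ^ 2 + z ^ 2)) ρ := by
  have hR := sqrt_sq_add_sq_pos z hρ
  refine (((hasDerivAt_pow 2 ρ).add_const (z ^ 2)).sqrt (by positivity)).congr_deriv ?_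
  field_simp
  norm_num

theorem hasDerivAt_sqrt_sq_add_sq_right {ρ : ℝ} (z : ℝ) (hρ : 0 < ρ) :
    HasDerivAt (fun t => √(ρ ^ 2 + t ^ 2)) (z / √(ρ ^ 2 + z ^ 2)) z := by
  have hR := sqrt_sq_add_sq_pos z hρ
  refine (((hasDerivAt_pow 2 z).const_add (ρ ^ 2)).sqrt (by positivity)).congr_deriv ?_
  field_simp
  norm_num

theorem hasDerivAt_log_sqrt_add_div_left {ρ : ℝ} (z : ℝ) (hρ : 0 < ρ) :
    HasDerivAt (fun t => Real.log ((√(t ^ 2 + z ^ 2) + z) / t))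
      (-z / (ρ * √(ρ ^ 2 + z ^ 2))) ρ := by
  have hR := sqrt_sq_add_sq_pos z hρ
  have hRz := sqrt_sq_add_sq_add_pos z hρ
  have hsq : √(ρ ^ 2 + z ^ 2) ^ 2 = ρ ^ 2 + z ^ 2 := Real.sq_sqrt (by positivity)
  have h : HasDerivAt (fun t => (√(t ^ 2 + z ^ 2) + z) / t) _ ρ :=
    ((hasDerivAt_sqrt_sq_add_sq_left z hρ).add_const z).div (hasDerivAt_id' ρ) hρ.ne'
  refine (h.log (div_pos hRz hρ).ne').congr_deriv ?_
  generalize √(ρ ^ 2 + z ^ 2) = R at *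
  field_simp
  linear_combination -hsq

theorem hasDerivAt_log_sqrt_add_div_right {ρ : ℝ} (z : ℝ) (hρ : 0 < ρ) :
    HasDerivAt (fun t => Real.log ((√(ρ ^ 2 + t ^ 2) + t) / ρ)) (1 / √(ρ ^ 2 + z ^ 2)) z := by
  have hR := sqrt_sq_add_sq_pos z hρ
  have hRz := sqrt_sq_add_sq_add_pos z hρ
  have h : HasDerivAt (fun t => (√(ρ ^ 2 + t ^ 2) + t) / ρ) _ z :=
    ((hasDerivAt_sqrt_sq_add_sq_right z hρ).add (hasDerivAt_id' z)).div_const ρ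
  refine (h.log (div_pos hRz hρ).ne').congr_deriv ?_
  generalize √(ρ ^ 2 + z ^ 2) = R at *
  field_simp
  ring

/-- for the Taub-NUT generating function `U = U_n` (with `n ≠ 0`,
`k = 4n`) and its conjugate `H = H_n`, Tod's ansatz coefficients evaluate to
`ρ²(U_{ρz}² + U_{zz}²) = 4`, `V = 1 + 2n/R` and `F = 2nz/R`. -/
theorem taub_nut_metric_coefficients
    (n : ℝ) (hn : n ≠ 0) (k : ℝ) (hk : k = 4 * n)
    (R U H : ℝ → ℝ → ℝ)
    (hR : ∀ ρ z : ℝ, R ρ z = Real.sqrt (ρ ^ 2 + z ^ 2))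
    (hU : ∀ ρ z : ℝ,
      U ρ z = 2 * R ρ z - 2 * z * Real.log ((R ρ z + z) / ρ) + 2 * n * Real.log (ρ ^ 2))
    (hH : ∀ ρ z : ℝ,
      H ρ z = z * (R ρ z + 4 * n) + ρ ^ 2 * Real.log ((R ρ z + z) / ρ)) :
    ∀ ρ z : ℝ, 0 < ρ →
      ρ ^ 2 * ((pdrz U ρ z) ^ 2 + (pdzz U ρ z) ^ 2) = 4 ∧
      -(1 / k) * (ρ * pdr U ρ z +
          (pdr U ρ z) ^ 2 * pdzz U ρ z / ((pdrz U ρ z) ^ 2 + (pdzz U ρ z) ^ 2))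
        = 1 + 2 * n / R ρ z ∧
      -(1 / k) * (-(ρ * (pdr U ρ z) ^ 2 * pdrz U ρ z)
            / ((pdrz U ρ z) ^ 2 + (pdzz U ρ z) ^ 2)
          + ρ ^ 2 * pdz U ρ z + 2 * H ρ z)
        = 2 * n * z / R ρ z := by
  obtain rfl : R = fun ρ z => √(ρ ^ 2 + z ^ 2) := funext₂ hR
  obtain rfl := funext₂ hU
  subst hk
  intro ρ z hρ
  let U : ℝ → ℝ → ℝ := fun ρ z => 2 * √(ρ ^ 2 + z ^ 2)
    - 2 * z * Real.log ((√(ρ ^ 2 + z ^ 2) + z) / ρ) + 2 * n * Real.log (ρ ^ 2)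
  have hUz : ∀ r w : ℝ, 0 < r →
      pdz U r w = -2 * Real.log ((√(r ^ 2 + w ^ 2) + w) / r) := by
    intro r w hr
    have hpos := sqrt_sq_add_sq_pos w hr
    have h := (((hasDerivAt_sqrt_sq_add_sq_right w hr).const_mul 2).sub
      (((hasDerivAt_id w).const_mul 2).mul (hasDerivAt_log_sqrt_add_div_right w hr))).add_const
      (2 * n * Real.log (r ^ 2))
    refine h.deriv.trans ?_
    simp only [id]
    ring
  have hUzz : pdzz U ρ z = -2 / √(ρ ^ 2 + z ^ 2) := by
    have hfun : (fun t => pdz U ρ t) =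
        fun t => -2 * Real.log ((√(ρ ^ 2 + t ^ 2) + t) / ρ) := funext fun t => hUz ρ t hρ
    rw [pdzz, hfun, ((hasDerivAt_log_sqrt_add_div_right z hρ).const_mul (-2)).deriv]
    ring
  have hUrz : pdrz U ρ z = 2 * z / (ρ * √(ρ ^ 2 + z ^ 2)) := by
    have hfun : (fun t => pdz U t z) =ᶠ[nhds ρ]
        fun t => -2 * Real.log ((√(t ^ 2 + z ^ 2) + z) / t) := by
      filter_upwards [lt_mem_nhds hρ] with t ht using hUz t z ht
    rw [pdrz, hfun.deriv_eq, ((hasDerivAt_log_sqrt_add_div_left z hρ).const_mul (-2)).deriv]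
    ring
  have hR0 := sqrt_sq_add_sq_pos z hρ
  have hsq : √(ρ ^ 2 + z ^ 2) ^ 2 = ρ ^ 2 + z ^ 2 := Real.sq_sqrt (by positivity)
  have hUr : pdr U ρ z = (2 * √(ρ ^ 2 + z ^ 2) + 4 * n) / ρ := by
    have h := (((hasDerivAt_sqrt_sq_add_sq_left z hρ).const_mul 2).sub
      ((hasDerivAt_log_sqrt_add_div_left z hρ).const_mul (2 * z))).add
      (((hasDerivAt_pow 2 ρ).log (pow_pos hρ 2).ne').const_mul (2 * n))
    refine h.deriv.trans ?_
    generalize √(ρ ^ 2 + z ^ 2) = R at *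
    field_simp
    push_cast
    linear_combination -2 * ρ * hsq
  have hsum : pdrz U ρ z ^ 2 + pdzz U ρ z ^ 2 = 4 / ρ ^ 2 := by
    rw [hUrz, hUzz]
    generalize √(ρ ^ 2 + z ^ 2) = R at *
    field_simp
    linear_combination -4 * hsq
  rw [hsum, hUr, hUrz, hUzz, hUz ρ z hρ, hH]
  beta_reduce
  generalize Real.log ((√(ρ ^ 2 + z ^ 2) + z) / ρ) = L at *
  generalize √(ρ ^ 2 + z ^ 2) = R at *
  refine ⟨?_, ?_, ?_⟩ <;> field_simp <;> ring
end

section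
/- Let W : ℝ² → ℝ be twice continuously differentiable on the open half-plane H = {(ρ,z) : ρ > 0} and satisfy the axisymmetric Laplace equation ∂²W/∂ρ² + (1/ρ)·∂W/∂ρ + ∂²W/∂z² = 0 on H. Suppose there exists ε > 0 such that W(ρ,z) < 0 whenever (ρ,z) ∈ H and either ρ < ε or ρ² + z² > 1/ε². Then W(ρ,z) < 0 for every (ρ,z) ∈ H. -/
open Real Set

/-- The second derivative of a function is nonpositive at a local maximum. -/
lemma IsLocalMax.deriv_deriv_nonpos {f : ℝ → ℝ} {x : ℝ} (h : IsLocalMax f x)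
    (hf : ContinuousAt f x) : deriv (deriv f) x ≤ 0 := by
  by_contra! hpos
  have hmin : IsLocalMin f x := isLocalMin_of_deriv_deriv_pos hpos h.deriv_eq_zero hf
  have hconst : f =ᶠ[nhds x] fun _ => f x := by
    filter_upwards [h, hmin] with y hy hy' using le_antisymm hy hy'
  have hzero := hconst.deriv.deriv_eq
  simp at hzero
  linarith

/-- A function of class `C²` near a point where `f'' + f' / x + c = 0` with `c ≤ 0` has no
local maximum there after adding a positive multiple of the square. -/
lemma not_isLocalMax_add_mul_sq {f : ℝ → ℝ} {x c η : ℝ} (hx : 0 < x) (hη : 0 < η)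
    (hf : ContDiffOn ℝ 2 f (Ioi 0)) (hc : c ≤ 0)
    (heq : deriv (deriv f) x + (1 / x) * deriv f x + c = 0) :
    ¬ IsLocalMax (fun t => f t + η * t ^ 2) x := by
  intro hmax
  have hd : ∀ t, 0 < t → DifferentiableAt ℝ f t := fun t ht =>
    (hf.differentiableOn (by norm_num)).differentiableAt (Ioi_mem_nhds ht)
  have hd' : DifferentiableAt ℝ (deriv f) x :=
    ((hf.deriv_of_isOpen (m := 1) isOpen_Ioi (by norm_num)).differentiableOn
      (by norm_num)).differentiableAt (Ioi_mem_nhds hx)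
  have h1 : ∀ t, 0 < t → HasDerivAt (fun t => f t + η * t ^ 2) (deriv f t + η * (2 * t)) t := by
    intro t ht
    simpa [Pi.add_def] using (hd t ht).hasDerivAt.add ((hasDerivAt_pow 2 t).const_mul η)
  have h2 : deriv (fun t => f t + η * t ^ 2) =ᶠ[nhds x] fun t => deriv f t + η * (2 * t) := by
    filter_upwards [Ioi_mem_nhds hx] with t ht using (h1 t ht).deriv
  have h3 : deriv (deriv (fun t => f t + η * t ^ 2)) x = deriv (deriv f) x + η * 2 := by
    rw [h2.deriv_eq]
    simpa [Pi.add_def] using (hd'.hasDerivAt.add (((hasDerivAt_id x).const_mul 2).const_mul η)).deriv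
  have h4 := hmax.deriv_deriv_nonpos (h1 x hx).continuousAt
  have h5 := hmax.hasDerivAt_eq_zero (h1 x hx)
  have h6 : (1 / x) * deriv f x = -(2 * η) := by
    field_simp
    linarith
  rw [h3] at h4
  linarith

/-- maximum principle for the axisymmetric Laplace equation on the
half-plane `{ρ > 0}`: if `W` is negative near the boundary `ρ = 0` and near
infinity, then `W` is negative everywhere on the half-plane. -/
theorem axisymmetric_maximum_principle
    (W : ℝ → ℝ → ℝ)
    (hC : ∀ p : ℝ × ℝ, 0 < p.1 → ContDiffAt ℝ 2 (fun q : ℝ × ℝ => W q.1 q.2) p)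
    (heq : ∀ ρ z : ℝ, 0 < ρ →
      pdrr W ρ z + (1 / ρ) * pdr W ρ z + pdzz W ρ z = 0)
    (hbd : ∃ ε : ℝ, 0 < ε ∧ ∀ ρ z : ℝ, 0 < ρ →
      (ρ < ε ∨ ρ ^ 2 + z ^ 2 > 1 / ε ^ 2) → W ρ z < 0) :
    ∀ ρ z : ℝ, 0 < ρ → W ρ z < 0 := by
  obtain ⟨ε, hε, hneg⟩ := hbd
  intro ρ₀ z₀ hρ₀
  by_contra! hW
  have hcont : ∀ p : ℝ × ℝ, 0 < p.1 → ContinuousAt (fun q : ℝ × ℝ => W q.1 q.2) p :=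
    fun p hp => (hC p hp).continuousAt
  have hε' : 0 < 1 / ε := by positivity
  obtain ⟨R, hR⟩ : ∃ R, R = 1 / ε + ε := ⟨_, rfl⟩
  have hR0 : 0 < R := by linarith
  have hR2 : 1 / ε ^ 2 < R ^ 2 := by
    rw [← one_div_pow]
    gcongr
    linarith
  have hfar : ∀ ρ z, 0 < ρ → R ^ 2 ≤ ρ ^ 2 + z ^ 2 → W ρ z < 0 := fun ρ z hρ h =>
    hneg ρ z hρ (Or.inr (by linarith))
  have hmem₀ : ρ₀ ∈ Icc (ε / 2) R ∧ z₀ ∈ Icc (-R) R := by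
    have h1 : ε ≤ ρ₀ := by
      by_contra! h
      exact hW.not_gt (hneg _ _ hρ₀ (Or.inl h))
    have h2 : ρ₀ ^ 2 + z₀ ^ 2 < R ^ 2 := by
      by_contra! h
      exact hW.not_gt (hfar _ _ hρ₀ h)
    have h3 := abs_le_of_sq_le_sq' (by nlinarith : z₀ ^ 2 ≤ R ^ 2) hR0.le
    have h4 := abs_le_of_sq_le_sq' (by nlinarith : ρ₀ ^ 2 ≤ R ^ 2) hR0.le
    exact ⟨⟨by linarith, h4.2⟩, h3⟩
  obtain ⟨K, hKdef⟩ : ∃ K : Set (ℝ × ℝ), K = Icc (ε / 2) R ×ˢ Icc (-R) R := ⟨_, rfl⟩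
  have hK : IsCompact K := hKdef ▸ isCompact_Icc.prod isCompact_Icc
  have hKpos : ∀ p ∈ K, 0 < p.1 := by
    intro p hp
    rw [hKdef] at hp
    linarith [hp.1.1]
  have hfr : ∀ p ∈ K, p ∉ Ioo (ε / 2) R ×ˢ Ioo (-R) R → W p.1 p.2 < 0 := by
    intro p hp hp'
    have hpos := hKpos p hp
    rw [hKdef] at hp
    obtain ⟨⟨ha, hb⟩, hc, hd⟩ := hp
    rcases ha.eq_or_lt with ha | ha
    · exact hneg _ _ hpos (Or.inl (by linarith))
    refine hfar _ _ hpos ?_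
    by_contra! h
    have h3 := abs_lt_of_sq_lt_sq' (by nlinarith : p.2 ^ 2 < R ^ 2) hR0.le
    have h4 := abs_lt_of_sq_lt_sq' (by nlinarith : p.1 ^ 2 < R ^ 2) hR0.le
    exact hp' ⟨⟨ha, h4.2⟩, h3⟩
  obtain ⟨δ, hδ, hδW⟩ : ∃ δ > 0, ∀ p ∈ K \ (Ioo (ε / 2) R ×ˢ Ioo (-R) R), W p.1 p.2 ≤ -δ := by
    have hB : IsCompact (K \ (Ioo (ε / 2) R ×ˢ Ioo (-R) R)) :=
      hK.diff (isOpen_Ioo.prod isOpen_Ioo)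
    rcases (K \ (Ioo (ε / 2) R ×ˢ Ioo (-R) R)).eq_empty_or_nonempty with he | hne
    · exact ⟨1, one_pos, by simp [he]⟩
    · obtain ⟨q, hq, hqmax⟩ := hB.exists_isMaxOn hne
        (fun p hp => (hcont p (hKpos p hp.1)).continuousWithinAt)
      refine ⟨-W q.1 q.2, neg_pos.2 (hfr q hq.1 hq.2), fun p hp => ?_⟩
      rw [neg_neg]
      exact hqmax hp
  obtain ⟨η, hη, hηδ⟩ : ∃ η > 0, η * R ^ 2 < δ := by
    refine ⟨δ / (2 * R ^ 2), by positivity, ?_⟩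
    field_simp
    linarith
  have hp₀ : (ρ₀, z₀) ∈ K := by
    rw [hKdef]
    exact hmem₀
  obtain ⟨⟨ρ, z⟩, hq, hqmax⟩ := hK.exists_isMaxOn
    (f := fun q : ℝ × ℝ => W q.1 q.2 + η * q.1 ^ 2) ⟨_, hp₀⟩
    (fun p hp => ((hcont p (hKpos p hp)).add (by fun_prop)).continuousWithinAt)
  have hρ : 0 < ρ := hKpos _ hq
  have hint : (ρ, z) ∈ Ioo (ε / 2) R ×ˢ Ioo (-R) R := by
    by_contra hout
    have h1 : W ρ z ≤ -δ := hδW (ρ, z) ⟨hq, hout⟩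
    have h2 : W ρ₀ z₀ + η * ρ₀ ^ 2 ≤ W ρ z + η * ρ ^ 2 := hqmax hp₀
    have h3 : ρ ≤ R := by
      rw [hKdef] at hq
      exact hq.1.2
    have h4 : η * ρ ^ 2 ≤ η * R ^ 2 := by gcongr
    have h5 : 0 < η * ρ₀ ^ 2 := by positivity
    linarith
  have hKnhds : K ∈ nhds (ρ, z) :=
    Filter.mem_of_superset ((isOpen_Ioo.prod isOpen_Ioo).mem_nhds hint)
      (hKdef ▸ prod_mono Ioo_subset_Icc_self Ioo_subset_Icc_self)
  have hloc : IsLocalMax (fun q : ℝ × ℝ => W q.1 q.2 + η * q.1 ^ 2) (ρ, z) :=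
    hqmax.isLocalMax hKnhds
  have hlocr : IsLocalMax (fun t => W t z + η * t ^ 2) ρ :=
    hloc.comp_continuous (g := fun t : ℝ => (t, z)) (b := ρ) (by fun_prop)
  have hlocz : IsLocalMax (fun t => W ρ t) z := by
    have h : IsLocalMax (fun t => W ρ t + η * ρ ^ 2) z :=
      hloc.comp_continuous (g := fun t : ℝ => (ρ, t)) (b := z) (by fun_prop)
    filter_upwards [h] with t ht using le_of_add_le_add_right ht
  have hzz : pdzz W ρ z ≤ 0 :=
    hlocz.deriv_deriv_nonpos
      ((hcont (ρ, z) hρ).comp (f := fun t : ℝ => (ρ, t)) (by fun_prop))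
  refine not_isLocalMax_add_mul_sq hρ hη (fun t ht => ?_) hzz (heq ρ z hρ) hlocr
  exact ((hC (t, z) ht).comp (f := fun s : ℝ => (s, z)) t (by fun_prop)).contDiffWithinAt
end

section
/- Let r ≥ 1 be an integer, a₁, …, a_r > 0 with a₁ + ⋯ + a_r = 1, z₁ < ⋯ < z_r real numbers, and A > 0. For ρ > 0 define U(ρ,z) := A·log(ρ²) + Σ_{i=1}^r a_i·U₀(ρ, z − z_i), where U₀(ρ,z) := 2·R(ρ,z) + z·log((R(ρ,z) − z)/(R(ρ,z) + z)) and R(ρ,z) := √(ρ²+z²). Then for all ρ > 0 and z ∈ ℝ: ∂U/∂ρ > 0, ∂²U/∂z² < 0 (in particular (∂²U/∂ρ∂z)² + (∂²U/∂z²)² > 0), and ρ·∂U/∂ρ + (∂U/∂ρ)²·(∂²U/∂z²)/((∂²U/∂ρ∂z)² + (∂²U/∂z²)²) < 0. -/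
open Real Set

/-- `R(ρ,z) = √(ρ² + z²)`. -/
noncomputable def Rfun (ρ z : ℝ) : ℝ := Real.sqrt (ρ ^ 2 + z ^ 2)

/-- The model potential `U₀(ρ,z) = 2R + z log((R−z)/(R+z))`. -/
noncomputable def Uzero (ρ z : ℝ) : ℝ :=
  2 * Rfun ρ z + z * Real.log ((Rfun ρ z - z) / (Rfun ρ z + z))

lemma abs_lt_Rfun {ρ : ℝ} (hρ : 0 < ρ) (z : ℝ) : |z| < Rfun ρ z := by
  rw [Rfun, ← Real.sqrt_sq_eq_abs]
  exact Real.sqrt_lt_sqrt (sq_nonneg z) (by nlinarith [pow_pos hρ 2])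

lemma Rfun_pos {ρ : ℝ} (hρ : 0 < ρ) (z : ℝ) : 0 < Rfun ρ z :=
  (abs_nonneg z).trans_lt (abs_lt_Rfun hρ z)

lemma Rfun_sub_pos {ρ : ℝ} (hρ : 0 < ρ) (z : ℝ) : 0 < Rfun ρ z - z :=
  sub_pos.2 ((le_abs_self z).trans_lt (abs_lt_Rfun hρ z))

lemma Rfun_add_pos {ρ : ℝ} (hρ : 0 < ρ) (z : ℝ) : 0 < Rfun ρ z + z := by
  linarith [neg_le_abs z, abs_lt_Rfun hρ z]

lemma Rfun_sq (ρ z : ℝ) : Rfun ρ z ^ 2 = ρ ^ 2 + z ^ 2 :=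
  Real.sq_sqrt (by positivity)

lemma hasDerivAt_Rfun_left {ρ : ℝ} (hρ : 0 < ρ) (z : ℝ) :
    HasDerivAt (fun t => Rfun t z) (ρ / Rfun ρ z) ρ := by
  have h : HasDerivAt (fun t : ℝ => t ^ 2 + z ^ 2) (2 * ρ) ρ := by
    simpa using (hasDerivAt_pow 2 ρ).add_const (z ^ 2)
  exact (h.sqrt (by positivity)).congr_deriv (mul_div_mul_left _ _ two_ne_zero)

lemma hasDerivAt_Rfun_right {ρ : ℝ} (hρ : 0 < ρ) (z : ℝ) :
    HasDerivAt (fun t => Rfun ρ t) (z / Rfun ρ z) z := by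
  have h : HasDerivAt (fun t : ℝ => ρ ^ 2 + t ^ 2) (2 * z) z := by
    simpa using (hasDerivAt_pow 2 z).const_add (ρ ^ 2)
  exact (h.sqrt (by positivity)).congr_deriv (mul_div_mul_left _ _ two_ne_zero)

/-- The logarithmic term of `Uzero`, which is also its derivative in `z`. -/
noncomputable def logRatio (ρ z : ℝ) : ℝ := Real.log ((Rfun ρ z - z) / (Rfun ρ z + z))

lemma hasDerivAt_logRatio_left {ρ : ℝ} (hρ : 0 < ρ) (z : ℝ) :
    HasDerivAt (fun t => logRatio t z) (2 * z / (ρ * Rfun ρ z)) ρ := by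
  have hR := hasDerivAt_Rfun_left hρ z
  have h0 := Rfun_pos hρ z
  have h1 := Rfun_sub_pos hρ z
  have h2 := Rfun_add_pos hρ z
  have hq := Rfun_sq ρ z
  refine (((hR.sub_const z).fun_div (hR.add_const z) h2.ne').log
    (div_pos h1 h2).ne').congr_deriv ?_
  field_simp
  linear_combination (-2 * z) * hq

lemma hasDerivAt_logRatio_right {ρ : ℝ} (hρ : 0 < ρ) (z : ℝ) :
    HasDerivAt (fun t => logRatio ρ t) (-2 / Rfun ρ z) z := by
  have hR := hasDerivAt_Rfun_right hρ z
  have h0 := Rfun_pos hρ z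
  have h1 := Rfun_sub_pos hρ z
  have h2 := Rfun_add_pos hρ z
  refine (((hR.fun_sub (hasDerivAt_id' z)).fun_div (hR.fun_add (hasDerivAt_id' z)) h2.ne').log
    (div_pos h1 h2).ne').congr_deriv ?_
  field_simp
  ring

lemma hasDerivAt_Uzero_left {ρ : ℝ} (hρ : 0 < ρ) (z : ℝ) :
    HasDerivAt (fun t => Uzero t z) (2 * Rfun ρ z / ρ) ρ := by
  have h0 := Rfun_pos hρ z
  have hq := Rfun_sq ρ z
  refine (((hasDerivAt_Rfun_left hρ z).const_mul 2).fun_add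
    ((hasDerivAt_logRatio_left hρ z).const_mul z)).congr_deriv ?_
  field_simp
  linear_combination -hq

lemma hasDerivAt_Uzero_right {ρ : ℝ} (hρ : 0 < ρ) (z : ℝ) :
    HasDerivAt (fun t => Uzero ρ t) (logRatio ρ z) z := by
  have h0 := Rfun_pos hρ z
  refine (((hasDerivAt_Rfun_right hρ z).const_mul 2).fun_add
    ((hasDerivAt_id' z).fun_mul (hasDerivAt_logRatio_right hρ z))).congr_deriv ?_
  field_simp
  ring

section

variable {ι : Type*} [Fintype ι] {a zs : ι → ℝ} {A : ℝ} {U : ℝ → ℝ → ℝ} {ρ : ℝ}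

lemma pdr_eq (hU : ∀ ρ z, U ρ z = A * Real.log (ρ ^ 2) + ∑ i, a i * Uzero ρ (z - zs i))
    (hρ : 0 < ρ) (z : ℝ) :
    pdr U ρ z = 2 / ρ * (A + ∑ i, a i * Rfun ρ (z - zs i)) := by
  have h1 : HasDerivAt (fun t : ℝ => A * Real.log (t ^ 2)) (A * (2 * ρ / ρ ^ 2)) ρ := by
    simpa using ((hasDerivAt_pow 2 ρ).log (by positivity)).const_mul A
  have h2 := h1.add (HasDerivAt.fun_sum (u := Finset.univ) fun i _ =>
    (hasDerivAt_Uzero_left hρ (z - zs i)).const_mul (a i))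
  rw [pdr, funext fun t => hU t z]
  refine h2.deriv.trans ?_
  rw [mul_add, Finset.mul_sum]
  congr 1
  · field_simp
  · exact Finset.sum_congr rfl fun i _ => by ring

lemma pdz_eq (hU : ∀ ρ z, U ρ z = A * Real.log (ρ ^ 2) + ∑ i, a i * Uzero ρ (z - zs i))
    (hρ : 0 < ρ) (z : ℝ) :
    pdz U ρ z = ∑ i, a i * logRatio ρ (z - zs i) := by
  have h := (HasDerivAt.fun_sum (u := Finset.univ) fun i _ =>
    ((hasDerivAt_Uzero_right hρ (z - zs i)).comp_sub_const z (zs i)).const_mul (a i)).const_add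
    (A * Real.log (ρ ^ 2))
  rw [pdz, funext fun t => hU ρ t]
  exact h.deriv

lemma pdzz_eq (hU : ∀ ρ z, U ρ z = A * Real.log (ρ ^ 2) + ∑ i, a i * Uzero ρ (z - zs i))
    (hρ : 0 < ρ) (z : ℝ) :
    pdzz U ρ z = -2 * ∑ i, a i / Rfun ρ (z - zs i) := by
  have h := HasDerivAt.fun_sum (u := Finset.univ) fun i _ =>
    ((hasDerivAt_logRatio_right hρ (z - zs i)).comp_sub_const z (zs i)).const_mul (a i)
  rw [pdzz, funext fun t => pdz_eq hU hρ t]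
  refine h.deriv.trans ?_
  rw [Finset.mul_sum]
  exact Finset.sum_congr rfl fun i _ => by ring

lemma pdrz_eq (hU : ∀ ρ z, U ρ z = A * Real.log (ρ ^ 2) + ∑ i, a i * Uzero ρ (z - zs i))
    (hρ : 0 < ρ) (z : ℝ) :
    pdrz U ρ z = 2 / ρ * ∑ i, a i * ((z - zs i) / Rfun ρ (z - zs i)) := by
  have h := HasDerivAt.fun_sum (u := Finset.univ) fun i _ =>
    (hasDerivAt_logRatio_left hρ (z - zs i)).const_mul (a i)
  have he : (fun t => pdz U t z) =ᶠ[nhds ρ] fun t => ∑ i, a i * logRatio t (z - zs i) := by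
    filter_upwards [lt_mem_nhds hρ] with t ht using pdz_eq hU ht z
  rw [pdrz, he.deriv_eq]
  refine h.deriv.trans ?_
  rw [Finset.mul_sum]
  exact Finset.sum_congr rfl fun i _ => by ring

lemma sq_sum_mul_le (ha : ∀ i, 0 < a i) (hsum : ∑ i, a i = 1) (x : ι → ℝ) :
    (∑ i, a i * x i) ^ 2 ≤ ∑ i, a i * x i ^ 2 := by
  simpa [hsum] using Finset.sum_sq_le_sum_mul_sum_of_sq_le_mul Finset.univ
    (r := fun i => a i * x i) (f := a) (g := fun i => a i * x i ^ 2)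
    (fun i _ => (ha i).le) (fun i _ => mul_nonneg (ha i).le (sq_nonneg _)) fun i _ =>
      le_of_eq (by ring)

lemma one_le_sum_mul_mul_sum_div (ha : ∀ i, 0 < a i) (hsum : ∑ i, a i = 1) {x : ι → ℝ}
    (hx : ∀ i, 0 < x i) : 1 ≤ (∑ i, a i * x i) * ∑ i, a i / x i := by
  simpa [hsum] using Finset.sum_sq_le_sum_mul_sum_of_sq_le_mul Finset.univ
    (r := a) (f := fun i => a i * x i) (g := fun i => a i / x i)
    (fun i _ => (mul_pos (ha i) (hx i)).le) (fun i _ => (div_pos (ha i) (hx i)).le)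
    fun i _ => le_of_eq (by have := (hx i).ne'; field_simp)

lemma sq_sum_add_sq_sum_le_one (ha : ∀ i, 0 < a i) (hsum : ∑ i, a i = 1) (hρ : 0 < ρ)
    (w : ι → ℝ) :
    (∑ i, a i * (w i / Rfun ρ (w i))) ^ 2 + (ρ * ∑ i, a i / Rfun ρ (w i)) ^ 2 ≤ 1 := by
  have h1 := sq_sum_mul_le ha hsum fun i => w i / Rfun ρ (w i)
  have h2 := sq_sum_mul_le ha hsum fun i => ρ / Rfun ρ (w i)
  have h3 : ρ * ∑ i, a i / Rfun ρ (w i) = ∑ i, a i * (ρ / Rfun ρ (w i)) := by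
    rw [Finset.mul_sum]
    exact Finset.sum_congr rfl fun i _ => by ring
  rw [h3]
  refine (add_le_add h1 h2).trans_eq ?_
  rw [← Finset.sum_add_distrib, ← hsum]
  refine Finset.sum_congr rfl fun i _ => ?_
  have := (Rfun_pos hρ (w i)).ne'
  field_simp
  rw [Rfun_sq]
  ring

end

/-- the generating function
`U(ρ,z) = A log(ρ²) + Σᵢ aᵢ U₀(ρ, z − zᵢ)` associated to a convex piecewise
linear function `f(z) = A + Σᵢ aᵢ|z − zᵢ|` with `A > 0`, `aᵢ > 0`, `Σ aᵢ = 1`,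
satisfies `U_ρ > 0`, `U_zz < 0` and the positivity condition
`ρU_ρ + U_ρ²U_zz/(U_{ρz}² + U_zz²) < 0` on the half-plane `ρ > 0`. -/
theorem generating_function_positivity
    (r : ℕ) (hr : 1 ≤ r)
    (a zs : Fin r → ℝ)
    (ha : ∀ i, 0 < a i) (hsum : ∑ i, a i = 1)
    (hzs : StrictMono zs)
    (A : ℝ) (hA : 0 < A)
    (U : ℝ → ℝ → ℝ)
    (hU : ∀ ρ z : ℝ,
      U ρ z = A * Real.log (ρ ^ 2) + ∑ i, a i * Uzero ρ (z - zs i)) :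
    ∀ ρ z : ℝ, 0 < ρ →
      0 < pdr U ρ z ∧
      pdzz U ρ z < 0 ∧
      0 < (pdrz U ρ z) ^ 2 + (pdzz U ρ z) ^ 2 ∧
      ρ * pdr U ρ z +
        (pdr U ρ z) ^ 2 * pdzz U ρ z
          / ((pdrz U ρ z) ^ 2 + (pdzz U ρ z) ^ 2) < 0 := by
  intro ρ z hρ
  rw [pdr_eq hU hρ, pdzz_eq hU hρ, pdrz_eq hU hρ]
  have hR : ∀ i, 0 < Rfun ρ (z - zs i) := fun i => Rfun_pos hρ _
  have : Nonempty (Fin r) := ⟨⟨0, hr⟩⟩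
  have hS : 0 < ∑ i, a i * Rfun ρ (z - zs i) :=
    Finset.sum_pos (fun i _ => mul_pos (ha i) (hR i)) Finset.univ_nonempty
  have hT : 0 < ∑ i, a i / Rfun ρ (z - zs i) :=
    Finset.sum_pos (fun i _ => div_pos (ha i) (hR i)) Finset.univ_nonempty
  have hST := one_le_sum_mul_mul_sum_div ha hsum hR
  have hCT := sq_sum_add_sq_sum_le_one ha hsum hρ fun i => z - zs i
  set S := ∑ i, a i * Rfun ρ (z - zs i)
  set T := ∑ i, a i / Rfun ρ (z - zs i)
  set C := ∑ i, a i * ((z - zs i) / Rfun ρ (z - zs i))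
  have hAT : 0 < A * T := mul_pos hA hT
  have hD : 0 < (2 / ρ * C) ^ 2 + (-2 * T) ^ 2 :=
    add_pos_of_nonneg_of_pos (sq_nonneg _) (by rw [neg_mul, neg_sq]; positivity)
  refine ⟨by positivity, by linarith, hD, ?_⟩
  have key : ρ * (2 / ρ * (A + S)) + (2 / ρ * (A + S)) ^ 2 * (-2 * T) /
      ((2 / ρ * C) ^ 2 + (-2 * T) ^ 2) =
      8 * (A + S) / ρ ^ 2 * (C ^ 2 + (ρ * T) ^ 2 - (A + S) * T) /
        ((2 / ρ * C) ^ 2 + (-2 * T) ^ 2) := by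
    rw [eq_div_iff hD.ne', add_mul, div_mul_cancel₀ _ hD.ne']
    field_simp
    ring
  rw [key]
  exact div_neg_of_neg_of_pos (mul_neg_of_pos_of_neg (by positivity) (by nlinarith)) hD
end

section
/- Let r ≥ 1 be an integer, let p₀ < p₁ < ⋯ < p_r be real numbers with p₀ = −1 and p_r = 1, and let f₁, …, f_r be positive real numbers. Assume: (a) for every j with 1 ≤ j ≤ r−1 such that p_j ≠ 0, there exists an integer ℓ_j with p_{j−1} + p_{j+1} = ℓ_j·p_j and f_{j+1}²·(p_{j+1} − p_j) = f_j²·(p_j − p_{j−1}); (b) for every j with 1 ≤ j ≤ r−1 such that p_j = 0, one has p_{j+1} = −p_{j−1}; (c) for every j with 1 ≤ j ≤ r−1, if p_j < 0 then f_{j+1} < f_j, and if p_j > 0 then f_{j+1} > f_j. Then for every j with 1 ≤ j ≤ r−1 one has p_{j−1} < 0 and p_{j+1} > 0; in particular r ≤ 3. -/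
/-- If a positive weight decreases while the products with the increments agree,
the increments grow. -/
theorem sub_lt_sub_of_sq_mul_eq {x y u v : ℝ} (hy : 0 < y) (hyx : y < x) (hu : 0 < u)
    (h : y ^ 2 * v = x ^ 2 * u) : u < v := by
  by_contra! hvu
  have hsq : y ^ 2 < x ^ 2 := by gcongr
  have h1 : y ^ 2 * v ≤ y ^ 2 * u := by gcongr
  have h2 : y ^ 2 * u < x ^ 2 * u := by gcongr
  linarith

/-- A convex integral relation at a negative slope forces the next slope to be positive. -/
theorem pos_of_add_eq_int_mul {a b c : ℝ} {ℓ : ℤ} (hab : a < b) (hb : b < 0)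
    (hgap : b - a < c - b) (h : a + c = ℓ * b) : 0 < c := by
  have hlt : (ℓ : ℝ) < 2 := by
    by_contra! hge
    nlinarith
  have hle : (ℓ : ℝ) ≤ 1 := by
    have : ℓ < 2 := by exact_mod_cast hlt
    exact_mod_cast (by omega : ℓ ≤ 1)
  nlinarith


/-- the Delzant-type smoothness constraints on the slopes
`p₀ = −1 < p₁ < ⋯ < p_r = 1` and values `f₁, …, f_r > 0` of the convex piecewise
linear function of a smooth toric Hermitian Ricci-flat ALF instanton force, for
every interior index `j`, `p_{j−1} < 0` and `p_{j+1} > 0`; in particular `r ≤ 3`. -/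
theorem slope_constraints_bound
    (r : ℕ) (hr : 1 ≤ r)
    (p f : ℕ → ℝ)
    (hmono : ∀ i, i < r → p i < p (i + 1))
    (hp0 : p 0 = -1) (hpr : p r = 1)
    (hf : ∀ j, 1 ≤ j → j ≤ r → 0 < f j)
    (ha : ∀ j, 1 ≤ j → j + 1 ≤ r → p j ≠ 0 →
      ∃ ℓ : ℤ, p (j - 1) + p (j + 1) = (ℓ : ℝ) * p j ∧
        f (j + 1) ^ 2 * (p (j + 1) - p j) = f j ^ 2 * (p j - p (j - 1)))
    (hb : ∀ j, 1 ≤ j → j + 1 ≤ r → p j = 0 → p (j + 1) = - p (j - 1))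
    (hc : ∀ j, 1 ≤ j → j + 1 ≤ r →
      ((p j < 0 → f (j + 1) < f j) ∧ (0 < p j → f j < f (j + 1)))) :
    (∀ j, 1 ≤ j → j + 1 ≤ r → p (j - 1) < 0 ∧ 0 < p (j + 1)) ∧ r ≤ 3 := by
  have key : ∀ j, 1 ≤ j → j + 1 ≤ r → p (j - 1) < 0 ∧ 0 < p (j + 1) := by
    intro j hj hjr
    have h1 : p (j - 1) < p j := by
      simpa [Nat.sub_add_cancel hj] using hmono (j - 1) (by omega)
    have h2 : p j < p (j + 1) := hmono j (by omega)
    rcases lt_trichotomy (p j) 0 with hneg | hzero | hpos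
    · obtain ⟨ℓ, hℓ, hf2⟩ := ha j hj hjr hneg.ne
      have hgap := sub_lt_sub_of_sq_mul_eq (hf (j + 1) (by omega) hjr)
        ((hc j hj hjr).1 hneg) (sub_pos.2 h1) hf2
      exact ⟨h1.trans hneg, pos_of_add_eq_int_mul h1 hneg hgap hℓ⟩
    · exact ⟨hzero ▸ h1, hzero ▸ h2⟩
    · obtain ⟨ℓ, hℓ, hf2⟩ := ha j hj hjr hpos.ne'
      have hgap := sub_lt_sub_of_sq_mul_eq (hf j hj (by omega))
        ((hc j hj hjr).2 hpos) (sub_pos.2 h2) hf2.symm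
      have hprev : 0 < -p (j - 1) :=
        pos_of_add_eq_int_mul (a := -p (j + 1)) (b := -p j) (ℓ := ℓ)
          (by linarith) (by linarith) (by linarith) (by linarith)
      exact ⟨by linarith, hpos.trans h2⟩
  refine ⟨key, ?_⟩
  by_contra! hr3
  exact lt_asymm (key 1 le_rfl (by omega)).2 (key 3 (by omega) (by omega)).1
end

section
/- Let p, q ∈ (0,1), let ℓ₁, ℓ₂ be integers, and let f₁, f₂, f₃ be positive real numbers satisfying: 1 − q = ℓ₁·p, 1 − p = ℓ₂·q, (1−p)·f₁² = (p+q)·f₂², (p+q)·f₂² = (1−q)·f₃², f₂ < f₁, and f₂ < f₃. Then ℓ₁ = 1, ℓ₂ = 1, p + q = 1, f₁ = f₂/√q, and f₃ = f₂/√p. -/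
/-- An integer multiple of `p > 0` lying strictly between `0` and `2 * p` is `p` itself. -/
theorem int_eq_one_of_mul_mem_Ioo {p : ℝ} (hp : 0 < p) {n : ℤ}
    (h : (n : ℝ) * p ∈ Set.Ioo 0 (2 * p)) : n = 1 := by
  have h0 : (0 : ℝ) < n := pos_of_mul_pos_left h.1 hp.le
  have h2 : (n : ℝ) < 2 := lt_of_mul_lt_mul_right h.2 hp.le
  norm_cast at h0 h2
  omega

theorem lt_of_mul_sq_eq_mul_sq {a b x y : ℝ} (hb : 0 < b) (hy : 0 < y)
    (h : a * x ^ 2 = b * y ^ 2) (hyx : y < x) : a < b := by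
  have hsq : y ^ 2 < x ^ 2 := pow_lt_pow_left₀ hyx hy.le two_ne_zero
  by_contra! hba
  nlinarith [mul_le_mul_of_nonneg_right hba (sq_nonneg x)]

theorem eq_div_sqrt_of_mul_sq_eq_sq {a x y : ℝ} (ha : 0 < a) (hx : 0 ≤ x) (hy : 0 ≤ y)
    (h : a * x ^ 2 = y ^ 2) : x = y / Real.sqrt a := by
  rw [eq_div_iff (Real.sqrt_pos.2 ha).ne',
    ← sq_eq_sq₀ (mul_nonneg hx (Real.sqrt_nonneg a)) hy, mul_pow, Real.sq_sqrt ha.le, mul_comm, h]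

/-- the smoothness constraints at the two interior vertices of the
polytope of a toric Hermitian Ricci-flat ALF instanton with four finite edges
force `ℓ₁ = ℓ₂ = 1`, `p + q = 1`, `f₁ = f₂/√q` and `f₃ = f₂/√p`: the Chen–Teo
family. -/
theorem chen_teo_constraints
    (p q : ℝ) (hp : p ∈ Set.Ioo (0 : ℝ) 1) (hq : q ∈ Set.Ioo (0 : ℝ) 1)
    (ℓ₁ ℓ₂ : ℤ) (f₁ f₂ f₃ : ℝ)
    (hf₁ : 0 < f₁) (hf₂ : 0 < f₂) (hf₃ : 0 < f₃)
    (h₁ : 1 - q = (ℓ₁ : ℝ) * p)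
    (h₂ : 1 - p = (ℓ₂ : ℝ) * q)
    (h₃ : (1 - p) * f₁ ^ 2 = (p + q) * f₂ ^ 2)
    (h₄ : (p + q) * f₂ ^ 2 = (1 - q) * f₃ ^ 2)
    (h₅ : f₂ < f₁) (h₆ : f₂ < f₃) :
    ℓ₁ = 1 ∧ ℓ₂ = 1 ∧ p + q = 1 ∧
      f₁ = f₂ / Real.sqrt q ∧ f₃ = f₂ / Real.sqrt p := by
  obtain ⟨hp0, hp1⟩ := hp
  obtain ⟨hq0, hq1⟩ := hq
  have hpq : 0 < p + q := add_pos hp0 hq0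
  have hlt₁ := lt_of_mul_sq_eq_mul_sq hpq hf₂ h₃ h₅
  have hlt₂ := lt_of_mul_sq_eq_mul_sq hpq hf₂ h₄.symm h₆
  have hℓ₁ : ℓ₁ = 1 := int_eq_one_of_mul_mem_Ioo hp0
    (by rw [← h₁]; constructor <;> linarith)
  have hℓ₂ : ℓ₂ = 1 := int_eq_one_of_mul_mem_Ioo hq0
    (by rw [← h₂]; constructor <;> linarith)
  have hsum : p + q = 1 := by
    rw [hℓ₁, Int.cast_one, one_mul] at h₁
    linarith
  rw [hsum, one_mul] at h₃ h₄
  rw [← eq_sub_of_add_eq' hsum] at h₃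
  rw [← eq_sub_of_add_eq hsum] at h₄
  exact ⟨hℓ₁, hℓ₂, hsum, eq_div_sqrt_of_mul_sq_eq_sq hq0 hf₁.le hf₂.le h₃,
    eq_div_sqrt_of_mul_sq_eq_sq hp0 hf₃.le hf₂.le h₄.symm⟩
end

section
/- Let p₁ < p₂ < p₃ be nonzero real numbers, let f₂, f₃ > 0, k ≠ 0, ℓ ∈ ℝ, ε ∈ {−1, 1}, and let F₁, F₂, F₃ be real numbers with F₂ − F₁ = (2/k)·f₂²·(1/p₂ − 1/p₁) and F₃ − F₂ = (2/k)·f₃²·(1/p₃ − 1/p₂). If p₁ + ε·p₃ = ℓ·p₂ and p₁·F₁ + ε·p₃·F₃ = ℓ·p₂·F₂, then ε = 1 and f₃²·(p₃ − p₂) = f₂²·(p₂ − p₁). -/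
/-- at a vertex between three consecutive slopes `p₁ < p₂ < p₃`,
the lattice compatibility condition `p₁ + εp₃ = ℓp₂`, `p₁F₁ + εp₃F₃ = ℓp₂F₂`
together with the transition relations for the constants `F_i` forces `ε = 1`
and `f₃²(p₃ − p₂) = f₂²(p₂ − p₁)`. -/
theorem vertex_compatibility
    (p₁ p₂ p₃ : ℝ) (h₁₂ : p₁ < p₂) (h₂₃ : p₂ < p₃)
    (hp₁ : p₁ ≠ 0) (hp₂ : p₂ ≠ 0) (hp₃ : p₃ ≠ 0)
    (f₂ f₃ : ℝ) (hf₂ : 0 < f₂) (hf₃ : 0 < f₃)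
    (k : ℝ) (hk : k ≠ 0) (ℓ : ℝ)
    (ε : ℝ) (hε : ε = -1 ∨ ε = 1)
    (F₁ F₂ F₃ : ℝ)
    (hF₂ : F₂ - F₁ = (2 / k) * f₂ ^ 2 * (1 / p₂ - 1 / p₁))
    (hF₃ : F₃ - F₂ = (2 / k) * f₃ ^ 2 * (1 / p₃ - 1 / p₂))
    (hv₁ : p₁ + ε * p₃ = ℓ * p₂)
    (hv₂ : p₁ * F₁ + ε * p₃ * F₃ = ℓ * p₂ * F₂) :
    ε = 1 ∧ f₃ ^ 2 * (p₃ - p₂) = f₂ ^ 2 * (p₂ - p₁) := by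
  have h₂ : k * p₂ * (p₁ * (F₂ - F₁)) = 2 * (f₂ ^ 2 * (p₁ - p₂)) := by
    rw [hF₂]; field_simp
  have h₃ : k * p₂ * (p₃ * (F₃ - F₂)) = 2 * (f₃ ^ 2 * (p₂ - p₃)) := by
    rw [hF₃]; field_simp
  have key : ε * (f₃ ^ 2 * (p₃ - p₂)) = f₂ ^ 2 * (p₂ - p₁) := by
    linear_combination (-k * p₂ / 2) * hv₂ + (k * p₂ * F₂ / 2) * hv₁ - h₂ / 2 + ε / 2 * h₃
  have hpos₂ : 0 < f₂ ^ 2 * (p₂ - p₁) := mul_pos (pow_pos hf₂ 2) (sub_pos.2 h₁₂)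
  have hpos₃ : 0 < f₃ ^ 2 * (p₃ - p₂) := mul_pos (pow_pos hf₃ 2) (sub_pos.2 h₂₃)
  rcases hε with rfl | rfl
  · linarith
  · exact ⟨rfl, by linarith⟩
end

section
/- Let a, m, n be real numbers with a ≠ 0 and m > |n|, and set b := √(a² + m² − n²), k := 2(m+n), f₁ := b + a + m + n, f₂ := b − a + m + n, F₁ := (2/k)·f₁²·(1 − b/a), and F₂ := F₁ + (2/k)·f₂²·(1 + b/a). Then b > |a| > 0, k > 0, f₁ > 0, f₂ > 0, F₁ = −((b+m)² − (a+n)²)/a, and F₂ = 4n. In particular F₂ = 0 if and only if n = 0. -/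
/-- the edge constants of the Kerr–Taub-bolt family: with
`b = √(a² + m² − n²)`, `k = 2(m+n)`, `f₁ = b+a+m+n`, `f₂ = b−a+m+n`,
`F₁ = (2/k)f₁²(1 − b/a)` and `F₂ = F₁ + (2/k)f₂²(1 + b/a)`, one has `b > |a| > 0`,
`k > 0`, `f₁, f₂ > 0`, `F₁ = −((b+m)² − (a+n)²)/a` and `F₂ = 4n`; in particular
`F₂ = 0` iff `n = 0`. -/
theorem kerr_taub_bolt_edge_constants
    (a m n : ℝ) (ha : a ≠ 0) (hm : |n| < m)
    (b k f₁ f₂ F₁ F₂ : ℝ)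
    (hb : b = Real.sqrt (a ^ 2 + m ^ 2 - n ^ 2))
    (hk : k = 2 * (m + n))
    (hf₁ : f₁ = b + a + m + n)
    (hf₂ : f₂ = b - a + m + n)
    (hF₁ : F₁ = (2 / k) * f₁ ^ 2 * (1 - b / a))
    (hF₂ : F₂ = F₁ + (2 / k) * f₂ ^ 2 * (1 + b / a)) :
    |a| < b ∧ 0 < |a| ∧ 0 < k ∧ 0 < f₁ ∧ 0 < f₂ ∧
      F₁ = -((b + m) ^ 2 - (a + n) ^ 2) / a ∧
      F₂ = 4 * n ∧ (F₂ = 0 ↔ n = 0) := by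
  have hs : 0 < m + n := by linarith [neg_abs_le n]
  have hd : 0 < m - n := by linarith [le_abs_self n]
  have hsd : 0 < (m + n) * (m - n) := mul_pos hs hd
  have hsq : b ^ 2 = a ^ 2 + m ^ 2 - n ^ 2 := by
    rw [hb, Real.sq_sqrt]
    nlinarith [sq_nonneg a]
  have hab : |a| < b := by
    rw [hb]
    apply Real.lt_sqrt_of_sq_lt
    rw [sq_abs]
    linarith
  obtain ⟨hab₁, hab₂⟩ := abs_lt.mp hab
  have hF₁' : F₁ = -((b + m) ^ 2 - (a + n) ^ 2) / a := by
    rw [hF₁, hf₁, hk]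
    field_simp
    linear_combination (-(b + a + m + n)) * hsq
  have hF₂' : F₂ = 4 * n := by
    rw [hF₂, hF₁', hf₂, hk]
    field_simp
    linear_combination (b - a + m + n) * hsq
  refine ⟨hab, abs_pos.mpr ha, by linarith, by linarith, by linarith, hF₁', hF₂', ?_⟩
  rw [hF₂']
  simp
end

section
/- Let a, m, n be real numbers with a ≠ 0, n ≠ 0, and m > |n|, and set b := √(a² + m² − n²), k := 2(m+n), f₁ := b + a + m + n, f₂ := b − a + m + n, F₁ := (2/k)·f₁²·(1 − b/a), F₂ := F₁ + (2/k)·f₂²·(1 + b/a), ℓ := n/|n|, α₀ := ((b+m)² − (a−n)²)/(4|n|·b), and α₂ := ((b+m)² − (a+n)²)/(4|n|·b). Then: (i) α₀ > 0 and α₂ > 0; (ii) α₂ − α₀ = −ℓ·a/b; (iii) α₂·F₂ = −ℓ·(a/b)·F₁. -/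
/-- The square root defining `b` exceeds `|a|`, so `b + m` exceeds `|a| + |n|`. -/
theorem abs_add_lt_sqrt_add {a m n x : ℝ} (hx : |x| ≤ |a| + |n|) (hm : |n| < m) :
    |x| < √(a ^ 2 + m ^ 2 - n ^ 2) + m := by
  have hsq : n ^ 2 < m ^ 2 := sq_lt_sq.2 (hm.trans_le (le_abs_self m))
  have hb : |a| < √(a ^ 2 + m ^ 2 - n ^ 2) :=
    Real.lt_sqrt_of_sq_lt (by rw [sq_abs]; linarith)
  linarith

/-- the Kerr–Taub-bolt cone angles `α₀, α₂` are positive and satisfy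
the vertex relations `α₂ − α₀ = −ℓa/b` and `α₂F₂ = −ℓ(a/b)F₁` with `ℓ = sign n`,
so the Kerr–Taub-bolt metric extends with conical singularities of angles
`2πα₀, 2π, 2πα₂` along the three fixed divisors. -/
theorem kerr_taub_bolt_cone_angles
    (a m n : ℝ) (ha : a ≠ 0) (hn : n ≠ 0) (hm : |n| < m)
    (b k f₁ f₂ F₁ F₂ ℓ α₀ α₂ : ℝ)
    (hb : b = Real.sqrt (a ^ 2 + m ^ 2 - n ^ 2))
    (hk : k = 2 * (m + n))
    (hf₁ : f₁ = b + a + m + n)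
    (hf₂ : f₂ = b - a + m + n)
    (hF₁ : F₁ = (2 / k) * f₁ ^ 2 * (1 - b / a))
    (hF₂ : F₂ = F₁ + (2 / k) * f₂ ^ 2 * (1 + b / a))
    (hℓ : ℓ = n / |n|)
    (hα₀ : α₀ = ((b + m) ^ 2 - (a - n) ^ 2) / (4 * |n| * b))
    (hα₂ : α₂ = ((b + m) ^ 2 - (a + n) ^ 2) / (4 * |n| * b)) :
    0 < α₀ ∧ 0 < α₂ ∧
      α₂ - α₀ = -ℓ * a / b ∧
      α₂ * F₂ = -ℓ * (a / b) * F₁ := by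
  have hbsq : b ^ 2 = a ^ 2 + m ^ 2 - n ^ 2 := by
    rw [hb, Real.sq_sqrt]
    nlinarith [sq_nonneg a, sq_lt_sq.2 (hm.trans_le (le_abs_self m))]
  have hn_pos : 0 < |n| := abs_pos.2 hn
  have hb_pos : 0 < b := by
    rw [hb]
    refine Real.sqrt_pos.2 ?_
    nlinarith [sq_nonneg a, sq_lt_sq.2 (hm.trans_le (le_abs_self m))]
  have hs : m + n ≠ 0 := by linarith [neg_abs_le n]
  have hden : 0 < 4 * |n| * b := by positivity
  have num_pos {x : ℝ} (hx : |x| ≤ |a| + |n|) : 0 < (b + m) ^ 2 - x ^ 2 :=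
    sub_pos.2 <| sq_lt_sq.2 <|
      (hb ▸ abs_add_lt_sqrt_add hx hm : |x| < b + m).trans_le (le_abs_self _)
  have hF₂_eq : F₂ = 4 * n := by
    rw [hF₂, hF₁, hf₁, hf₂, hk]
    field_simp
    linear_combination (-2 * a) * hbsq
  refine ⟨?_, ?_, ?_, ?_⟩
  · rw [hα₀]
    exact div_pos (num_pos (abs_sub a n)) hden
  · rw [hα₂]
    exact div_pos (num_pos (abs_add_le a n)) hden
  · rw [hα₀, hα₂, hℓ]
    field_simp
    ring
  · rw [hF₂_eq, hα₂, hℓ, hF₁, hf₁, hk]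
    field_simp
    linear_combination (-(b + a + m + n)) * hbsq
end

section
/- Let k ≠ 0, let p_j < p_{j+1} be nonzero real numbers, let α_j, α_{j+1}, α > 0, f_{j+1} > 0, and let F_j, F_{j+1} be real numbers with F_{j+1} − F_j = (2/k)·f_{j+1}²·(1/p_{j+1} − 1/p_j). Set s := α_j·p_j + α_{j+1}·p_{j+1}, assume s ≠ 0, and define p := s/α and F := (α_j·p_j·F_j + α_{j+1}·p_{j+1}·F_{j+1})/s. Assume further d₋ := α_{j+1}·p_{j+1} − (α − α_j)·p_j ≠ 0 and d₊ := (α − α_{j+1})·p_{j+1} − α_j·p_j ≠ 0, and define f₋² := f_{j+1}²·(p_{j+1} − p_j)·α_{j+1}/d₋ and f₊² := f_{j+1}²·(p_{j+1} − p_j)·α_j/d₊. Then F − F_j = (2/k)·f₋²·(1/p − 1/p_j) and F_{j+1} − F = (2/k)·f₊²·(1/p_{j+1} − 1/p). -/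
/-- the algebraic core of the blow-up construction: inserting a new
edge, with cone angle `2πα`, slope `p = (αⱼpⱼ + αⱼ₊₁pⱼ₊₁)/α` and constant `F`
given by the weighted average, between two consecutive edges, the values `f₋², f₊²`
given by formula (119) satisfy the transition relations
`F − Fⱼ = (2/k)f₋²(1/p − 1/pⱼ)` and `Fⱼ₊₁ − F = (2/k)f₊²(1/pⱼ₊₁ − 1/p)`. -/
theorem blowup_transition_relations
    (k : ℝ) (hk : k ≠ 0)
    (pj pj1 : ℝ) (hlt : pj < pj1) (hpj : pj ≠ 0) (hpj1 : pj1 ≠ 0)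
    (αj αj1 α : ℝ) (hαj : 0 < αj) (hαj1 : 0 < αj1) (hα : 0 < α)
    (fj1 : ℝ) (hfj1 : 0 < fj1)
    (Fj Fj1 : ℝ)
    (hF : Fj1 - Fj = (2 / k) * fj1 ^ 2 * (1 / pj1 - 1 / pj))
    (s : ℝ) (hs : s = αj * pj + αj1 * pj1) (hs0 : s ≠ 0)
    (p F : ℝ) (hp : p = s / α)
    (hFdef : F = (αj * pj * Fj + αj1 * pj1 * Fj1) / s)
    (dm dp : ℝ)
    (hdm : dm = αj1 * pj1 - (α - αj) * pj) (hdm0 : dm ≠ 0)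
    (hdp : dp = (α - αj1) * pj1 - αj * pj) (hdp0 : dp ≠ 0)
    (fm2 fp2 : ℝ)
    (hfm2 : fm2 = fj1 ^ 2 * (pj1 - pj) * αj1 / dm)
    (hfp2 : fp2 = fj1 ^ 2 * (pj1 - pj) * αj / dp) :
    F - Fj = (2 / k) * fm2 * (1 / p - 1 / pj) ∧
    Fj1 - F = (2 / k) * fp2 * (1 / pj1 - 1 / p) := by
  have hminus : 1 / p - 1 / pj = -dm / (s * pj) := by
    rw [hp, one_div_div, div_sub_div _ _ hs0 hpj, hdm, hs]
    ring
  have hplus : 1 / pj1 - 1 / p = -dp / (s * pj1) := by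
    rw [hp, one_div_div, div_sub_div _ _ hpj1 hs0, hdp, hs]
    ring
  have hlower : F - Fj = αj1 * pj1 * (Fj1 - Fj) / s := by
    rw [hFdef, div_sub' hs0, hs]
    ring
  have hupper : Fj1 - F = αj * pj * (Fj1 - Fj) / s := by
    rw [hFdef, sub_div' hs0, hs]
    ring
  constructor
  · rw [hlower, hF, hfm2, hminus]
    field_simp
    ring
  · rw [hupper, hF, hfp2, hplus]
    field_simp
    ring
end
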